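/- Let f, g : (0,∞) → ℝ be measurable such that the function (x,u,y) ↦ y·x·exp(−x²y²)·|f(x)|·u·exp(−u²y²)·|g(u)| is integrable on (0,∞)³. Then the Parseval–Goldstein type identity ∫₀^∞ x·f(x)·P{g}(x) dx = ∫₀^∞ u·g(u)·P{f}(u) du holds. -/

import Mathlib

open MeasureTheory Real Set

/-- The first Gaussian moment on the half-line: `∫₀^∞ y exp(-b y²) dy = 1 / (2b)`. -/
theorem integral_Ioi_mul_exp_neg_mul_sq {b : ℝ} (hb : 0 < b) :
    ∫ y in Ioi (0 : ℝ), y * Real.exp (-b * y ^ 2) = (2 * b)⁻¹ := by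
  have h := integral_mul_cexp_neg_mul_sq (b := (b : ℂ)) (by simpa using hb)
  have hcast : ((∫ y in Ioi (0 : ℝ), y * Real.exp (-b * y ^ 2) : ℝ) : ℂ) = ((2 * b)⁻¹ : ℝ) := by
    rw [← integral_complex_ofReal]
    push_cast
    exact h
  exact_mod_cast hcast

/-- Integrability of the Gaussian triple kernel gives integrability of the kernel
`x f(x) u g(u) / (u² + x²)` on the quadrant. -/
theorem integrable_widder_kernel {f g : ℝ → ℝ}
    (hf : AEMeasurable f (volume.restrict (Ioi 0)))
    (hg : AEMeasurable g (volume.restrict (Ioi 0)))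
    (hint : IntegrableOn
      (fun p : ℝ × ℝ × ℝ =>
        p.2.2 * (p.1 * Real.exp (-(p.1 ^ 2) * p.2.2 ^ 2) * |f p.1|) *
          (p.2.1 * Real.exp (-(p.2.1 ^ 2) * p.2.2 ^ 2) * |g p.2.1|))
      (Ioi 0 ×ˢ Ioi 0 ×ˢ Ioi 0)) :
    Integrable (fun q : ℝ × ℝ => q.1 * f q.1 * (q.2 * g q.2 / (q.2 ^ 2 + q.1 ^ 2)))
      ((volume.restrict (Ioi 0)).prod (volume.restrict (Ioi 0))) := by
  rw [IntegrableOn, Measure.volume_eq_prod, Measure.volume_eq_prod, ← Measure.prod_restrict,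
    ← Measure.prod_restrict] at hint
  have hassoc := ((measurePreserving_prodAssoc (volume.restrict (Ioi (0 : ℝ)))
    (volume.restrict (Ioi (0 : ℝ))) (volume.restrict (Ioi (0 : ℝ)))).integrable_comp_emb
    MeasurableEquiv.prodAssoc.measurableEmbedding).2 hint
  have hmeas : AEStronglyMeasurable
      (fun q : ℝ × ℝ => q.1 * f q.1 * (q.2 * g q.2 / (q.2 ^ 2 + q.1 ^ 2)))
      ((volume.restrict (Ioi 0)).prod (volume.restrict (Ioi 0))) := by
    have hfst : AEMeasurable (fun q : ℝ × ℝ => f q.1)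
      ((volume.restrict (Ioi 0)).prod (volume.restrict (Ioi 0))) := hf.comp_fst
    have hgsnd : AEMeasurable (fun q : ℝ × ℝ => g q.2)
      ((volume.restrict (Ioi 0)).prod (volume.restrict (Ioi 0))) := hg.comp_snd
    exact AEMeasurable.aestronglyMeasurable (by fun_prop)
  refine (hassoc.integral_prod_left.const_mul 2).mono' hmeas ?_
  rw [Measure.prod_restrict]
  filter_upwards [ae_restrict_mem (measurableSet_Ioi.prod measurableSet_Ioi)] with q hq
  obtain ⟨hx, hu⟩ : 0 < q.1 ∧ 0 < q.2 := hq
  have hb : 0 < q.2 ^ 2 + q.1 ^ 2 := by positivity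
  refine le_of_eq ?_
  have hinner : ∫ y in Ioi (0 : ℝ), y * (q.1 * Real.exp (-(q.1 ^ 2) * y ^ 2) * |f q.1|) *
      (q.2 * Real.exp (-(q.2 ^ 2) * y ^ 2) * |g q.2|) =
      q.1 * |f q.1| * (q.2 * |g q.2|) * (2 * (q.2 ^ 2 + q.1 ^ 2))⁻¹ := by
    rw [← integral_Ioi_mul_exp_neg_mul_sq hb, ← integral_const_mul]
    congr with y
    rw [show -(q.2 ^ 2 + q.1 ^ 2) * y ^ 2 = -(q.1 ^ 2) * y ^ 2 + -(q.2 ^ 2) * y ^ 2 by ring,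
      Real.exp_add]
    ring
  simp only [Function.comp_def, MeasurableEquiv.prodAssoc, MeasurableEquiv.coe_mk,
    Equiv.prodAssoc_apply]
  rw [hinner, norm_mul, norm_div, norm_mul, norm_mul]
  simp only [Real.norm_eq_abs, abs_of_pos hx, abs_of_pos hu, abs_of_pos hb]
  field_simp

/-- Parseval–Goldstein type identity for the Widder potential transform:
`∫₀^∞ x f(x) P{g}(x) dx = ∫₀^∞ u g(u) P{f}(u) du`. -/
theorem parseval_goldstein_widder (f g : ℝ → ℝ)
    (hf : AEMeasurable f (volume.restrict (Ioi 0)))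
    (hg : AEMeasurable g (volume.restrict (Ioi 0)))
    (hint : IntegrableOn
      (fun p : ℝ × ℝ × ℝ =>
        p.2.2 * (p.1 * Real.exp (-(p.1 ^ 2) * p.2.2 ^ 2) * |f p.1|) *
          (p.2.1 * Real.exp (-(p.2.1 ^ 2) * p.2.2 ^ 2) * |g p.2.1|))
      (Ioi 0 ×ˢ Ioi 0 ×ˢ Ioi 0)) :
    ∫ x in Ioi (0 : ℝ),
        x * f x * ∫ u in Ioi (0 : ℝ), u * g u / (u ^ 2 + x ^ 2)
      = ∫ u in Ioi (0 : ℝ),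
          u * g u * ∫ x in Ioi (0 : ℝ), x * f x / (x ^ 2 + u ^ 2) := by
  simp only [← integral_const_mul]
  rw [integral_integral_swap (integrable_widder_kernel hf hg hint)]
  congr with u
  congr with x
  rw [add_comm (u ^ 2)]
  ring
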